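/- arXiv:0711.0478 — 3 statements merged into one kernel-verified Lean document; each statement's English description precedes it below -/
import Mathlib

section
/- For every α ∈ (0, π/4], one has exp(−(π/2)·cot α) < (1/2)·tan α. -/
open Real

theorem exp_neg_half_pi_cot_lt_half_tan (α : ℝ) (hα0 : 0 < α) (hα : α ≤ Real.pi / 4) :
    Real.exp (-(Real.pi / 2) * Real.cot α) < (1 / 2) * Real.tan α := by
  have hpi := Real.pi_gt_three
  have ht : 0 < Real.tan α := Real.tan_pos_of_pos_of_lt_pi_div_two hα0 (by linarith)
  have hc : Real.cot α = (Real.tan α)⁻¹ := by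
    rw [Real.cot_eq_cos_div_sin, Real.tan_eq_sin_div_cos, inv_div]
  rw [hc]
  have hcpos : 0 < (Real.tan α)⁻¹ := inv_pos.mpr ht
  have hr : (1 / 2) * Real.tan α = (2 * (Real.tan α)⁻¹)⁻¹ := by
    rw [mul_inv, inv_inv]; norm_num
  rw [hr]
  generalize (Real.tan α)⁻¹ = c at hcpos
  rw [neg_mul, Real.exp_neg]
  apply inv_strictAnti₀ (by positivity)
  have hy : 3 / 2 * c ≤ Real.pi / 2 * c := by gcongr
  have h := Real.quadratic_le_exp_of_nonneg (x := Real.pi / 2 * c) (by positivity)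
  nlinarith [sq_nonneg (Real.pi / 2 * c - 1)]
end

section
/- For every α ∈ (0, π/4], one has exp(−π·cot α) < sin α. -/
open Real

theorem exp_neg_pi_cot_lt_sin (α : ℝ) (hα0 : 0 < α) (hα : α ≤ Real.pi / 4) :
    Real.exp (-Real.pi * Real.cot α) < Real.sin α := by
  have hpi := Real.pi_gt_three
  have hs : 0 < Real.sin α := Real.sin_pos_of_pos_of_lt_pi hα0 (by linarith)
  have hc : 0 < Real.cos α := Real.cos_pos_of_mem_Ioo ⟨by linarith, by linarith⟩
  have h1 := Real.sin_sq_add_cos_sq α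
  have hsum : 1 < Real.sin α + Real.cos α := by nlinarith [mul_pos hs hc]
  have hx : 0 < Real.pi * Real.cot α := by
    rw [Real.cot_eq_cos_div_sin]; positivity
  have hcs : Real.cot α * Real.sin α = Real.cos α := by
    rw [Real.cot_eq_cos_div_sin]; field_simp
  have he := Real.add_one_le_exp (Real.pi * Real.cot α)
  rw [neg_mul, Real.exp_neg, inv_lt_iff_one_lt_mul₀ (Real.exp_pos _)]
  have h2 := mul_le_mul_of_nonneg_right he hs.le
  have h3 : (Real.pi * Real.cot α + 1) * Real.sin α
      = Real.pi * Real.cos α + Real.sin α := by rw [← hcs]; ring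
  nlinarith
end

section
/- Let H be a complex Hilbert space, let α ∈ [0, π/2), and let A be a bounded linear operator on H with 𝔑(A) ⊆ S_α. Then for every t ≥ 0 the operator I + t·A is boundedly invertible, and, writing F(t) := (I + t·A)^{-1}, one has 𝔑(F(t)) ⊆ S_α ∩ (1 − S_α) and 𝔑(I − F(t)) ⊆ S_α, where 1 − S_α := {1 − w : w ∈ S_α}. -/
open Real Set
open scoped InnerProductSpace

/-- The closed sector `S_α` with vertex `0` and semi-angle `α`. -/
def Sset (α : ℝ) : Set ℂ := {z : ℂ | |Complex.arg z| ≤ α}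

/-- The numerical range of a bounded operator on a complex Hilbert space. -/
def numRange {H : Type*} [NormedAddCommGroup H] [InnerProductSpace ℂ H]
    (T : H →L[ℂ] H) : Set ℂ :=
  {z : ℂ | ∃ u : H, ‖u‖ = 1 ∧ z = ⟪u, T u⟫_ℂ}

lemma mem_Sset_iff_tan (α : ℝ) (hα0 : 0 ≤ α) (hα : α < Real.pi / 2) (z : ℂ) :
    z ∈ Sset α ↔ 0 ≤ z.re ∧ |z.im| ≤ Real.tan α * z.re := by
  by_cases h0 : z = 0
  · subst h0; simp [Sset, hα0]
  by_cases hre : 0 < z.re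
  · have hlt : |z.arg| < Real.pi / 2 := Complex.abs_arg_lt_pi_div_two_iff.2 (Or.inl hre)
    have hl := abs_lt.1 hlt
    have m1 : z.arg ∈ Ioo (-(Real.pi / 2)) (Real.pi / 2) := ⟨hl.1, hl.2⟩
    have m2 : α ∈ Ioo (-(Real.pi / 2)) (Real.pi / 2) := ⟨by linarith, hα⟩
    have m3 : -α ∈ Ioo (-(Real.pi / 2)) (Real.pi / 2) := ⟨by linarith, by linarith⟩
    have e1 := Real.strictMonoOn_tan.le_iff_le m1 m2
    have e2 := Real.strictMonoOn_tan.le_iff_le m3 m1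
    rw [Complex.tan_arg, div_le_iff₀ hre] at e1
    rw [Complex.tan_arg, le_div_iff₀ hre, Real.tan_neg, neg_mul] at e2
    change |z.arg| ≤ α ↔ _
    rw [abs_le, abs_le, e1, e2]
    simp [hre.le]
  · constructor
    · intro h
      have : |z.arg| < Real.pi / 2 := lt_of_le_of_lt h hα
      rcases Complex.abs_arg_lt_pi_div_two_iff.1 this with h | h
      · exact absurd h hre
      · exact absurd h h0
    · rintro ⟨h1, h2⟩
      have hr : z.re = 0 := le_antisymm (not_lt.1 hre) h1
      rw [hr, mul_zero] at h2
      have hi : z.im = 0 := abs_eq_zero.1 (le_antisymm h2 (abs_nonneg _))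
      exact absurd (Complex.ext hr hi) h0

/-- The sector is stable under conjugation, nonnegative scaling and nonnegative translation. -/
lemma Sset_smul_add (α : ℝ) (hα0 : 0 ≤ α) (hα : α < Real.pi / 2) (z : ℂ) (hz : z ∈ Sset α)
    (s r : ℝ) (hs : 0 ≤ s) (hr : 0 ≤ r) : (s : ℂ) * z + (r : ℂ) ∈ Sset α := by
  rw [mem_Sset_iff_tan α hα0 hα] at hz ⊢
  have hk : 0 ≤ Real.tan α := Real.tan_nonneg_of_nonneg_of_le_pi_div_two hα0 hα.le
  obtain ⟨h1, h2⟩ := hz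
  have := mul_le_mul_of_nonneg_left h2 hs
  have := mul_nonneg hk hr
  have := mul_nonneg hs h1
  simp only [Complex.add_re, Complex.add_im, Complex.re_ofReal_mul, Complex.im_ofReal_mul,
    Complex.ofReal_re, Complex.ofReal_im, add_zero, abs_mul, abs_of_nonneg hs]
  constructor <;> nlinarith

lemma Sset_conj (α : ℝ) (hα0 : 0 ≤ α) (hα : α < Real.pi / 2) (z : ℂ) (hz : z ∈ Sset α) :
    (starRingEnd ℂ) z ∈ Sset α := by
  rw [mem_Sset_iff_tan α hα0 hα] at hz ⊢
  simpa using hz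

theorem resolvent_numRange_sector
    {H : Type*} [NormedAddCommGroup H] [InnerProductSpace ℂ H] [CompleteSpace H]
    (α : ℝ) (hα0 : 0 ≤ α) (hα : α < Real.pi / 2)
    (A : H →L[ℂ] H) (hA : numRange A ⊆ Sset α)
    (t : ℝ) (ht : 0 ≤ t) :
    ∃ F : H →L[ℂ] H,
      ((1 : H →L[ℂ] H) + (t : ℂ) • A) * F = 1 ∧
      F * ((1 : H →L[ℂ] H) + (t : ℂ) • A) = 1 ∧
      numRange F ⊆ Sset α ∩ ((fun w : ℂ => 1 - w) '' Sset α) ∧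
      numRange (1 - F) ⊆ Sset α := by
  have hq : ∀ v : H, ⟪v, A v⟫_ℂ ∈ Sset α := by
    intro v
    by_cases hv : v = 0
    · subst hv; simp [Sset, hα0]
    have hn : ‖v‖ ≠ 0 := norm_ne_zero_iff.2 hv
    have hn' : (‖v‖ : ℂ) ≠ 0 := by exact_mod_cast hn
    have h1 : ⟪((‖v‖⁻¹ : ℝ) : ℂ) • v, A (((‖v‖⁻¹ : ℝ) : ℂ) • v)⟫_ℂ ∈ Sset α := by
      refine hA ⟨_, ?_, rfl⟩
      rw [norm_smul, Complex.norm_real, norm_inv, norm_norm, inv_mul_cancel₀ hn]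
    have h2 := Sset_smul_add α hα0 hα _ h1 (‖v‖ ^ 2) 0 (by positivity) le_rfl
    rw [map_smul, inner_smul_left, inner_smul_right, Complex.conj_ofReal] at h2
    convert h2 using 1
    push_cast
    field_simp
    simp
  set B : H →L[ℂ] H := (1 : H →L[ℂ] H) + (t : ℂ) • A with hB
  have hBv : ∀ v, B v = v + (t : ℂ) • A v := fun v => by simp [hB]
  have hin : ∀ v, ⟪B v, v⟫_ℂ = (t : ℂ) * (starRingEnd ℂ) ⟪v, A v⟫_ℂ + ((‖v‖ ^ 2 : ℝ) : ℂ) := by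
    intro v
    rw [hBv, inner_add_left, inner_smul_left, Complex.conj_ofReal, inner_conj_symm,
      inner_self_eq_norm_sq_to_K]
    push_cast
    exact add_comm _ _
  have hU : IsUnit B := by
    refine ContinuousLinearMap.isUnit_of_forall_le_norm_inner_map B (c := 1) one_pos ?_
    intro v
    refine le_trans ?_ (Complex.re_le_norm _)
    rw [hin]
    have := mul_nonneg ht ((mem_Sset_iff_tan α hα0 hα _).1 (hq v)).1
    simp only [Complex.add_re, Complex.re_ofReal_mul, Complex.ofReal_re, Complex.conj_re,
      NNReal.coe_one, mul_one]
    linarith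
  obtain ⟨U, hUB⟩ := hU
  have hr : B * (↑U⁻¹ : H →L[ℂ] H) = 1 := by rw [← hUB]; exact U.mul_inv
  have hl : (↑U⁻¹ : H →L[ℂ] H) * B = 1 := by rw [← hUB]; exact U.inv_mul
  generalize (↑U⁻¹ : H →L[ℂ] H) = F at hr hl
  have hBF : ∀ u, B (F u) = u := fun u => by
    have := congrArg (fun T : H →L[ℂ] H => T u) hr
    simpa using this
  have h1F : ∀ u, ⟪u, u - F u⟫_ℂ ∈ Sset α := by
    intro u
    obtain ⟨v, hv⟩ : ∃ v, v = F u := ⟨_, rfl⟩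
    have hu : u = v + (t : ℂ) • A v := by rw [← hBv, hv, hBF]
    have := Sset_smul_add α hα0 hα _ (hq v) t (t ^ 2 * ‖A v‖ ^ 2) ht (by positivity)
    rw [← hv]
    convert this using 1
    have e : u - v = (t : ℂ) • A v := by rw [hu]; abel
    rw [e, hu, inner_smul_right, inner_add_left, inner_smul_left, Complex.conj_ofReal,
      inner_self_eq_norm_sq_to_K]
    push_cast
    simp only [Complex.coe_algebraMap]
    ring
  refine ⟨F, hr, hl, ?_, ?_⟩
  · rintro z ⟨u, hu, rfl⟩
    refine ⟨?_, ⟪u, u - F u⟫_ℂ, h1F u, ?_⟩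
    · have := Sset_smul_add α hα0 hα _ (Sset_conj α hα0 hα _ (hq (F u))) t (‖F u‖ ^ 2) ht
        (by positivity)
      rw [← hin, hBF] at this
      exact this
    · simp [inner_sub_right, inner_self_eq_norm_sq_to_K, hu]
  · rintro z ⟨u, hu, rfl⟩
    simpa using h1F u
end
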